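/- Let p and q be distinct odd primes with p dividing q − 1, and assume 2^{q−1} ≢ 1 (mod q²). Let A(X) = Σ_{t=0}^{pq²−1} s_t X^t ∈ F₂[X] be the generating polynomial of one period of the binary threshold sequence s. Then the linear complexity L(s) = pq² − deg(gcd(X^{pq²} − 1, A(X))) of s equals (p−1)(q² − q) if q ≡ 1 (mod 4), and equals (p−1)(q² − 1) if q ≡ 3 (mod 4). -/

import Mathlib

/-- Euler quotient modulo `p*q`: for `gcd(t, pq) = 1` it is the unique integer in
`{0, ..., pq-1}` congruent to `(t^((p-1)(q-1)) - 1)/(pq)` modulo `pq`; it is `0` otherwise. -/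
def eulerQuotient (p q t : ℕ) : ℕ :=
  if Nat.gcd t (p * q) = 1 then ((t ^ ((p - 1) * (q - 1)) - 1) / (p * q)) % (p * q) else 0

/-- The binary threshold sequence over `F₂`: `s t = 0` if `ψ(t)/(pq) < 1/2`, else `1`. -/
def binSeq (p q t : ℕ) : ZMod 2 :=
  if 2 * eulerQuotient p q t < p * q then 0 else 1

/-- `D ℓ = { t : 0 ≤ t < pq², gcd(t, pq) = 1, ψ(t) ≡ p·ℓ (mod pq) }`. -/
def Dset (p q ℓ : ℕ) : Finset ℕ :=
  (Finset.range (p * q ^ 2)).filter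
    (fun t => Nat.gcd t (p * q) = 1 ∧ eulerQuotient p q t ≡ p * ℓ [MOD p * q])

/-- The Fermat quotient `(t ^ (q - 1) - 1) / q` modulo `q`. -/
def fermatQuotient (q t : ℕ) : ZMod q :=
  (((t ^ (q - 1) - 1) / q : ℕ) : ZMod q)

lemma exists_pow_eq_one_add_mul_fermatQuotient {q t : ℕ} (hq : q.Prime) (ht : t.Coprime q) :
    ∃ m, t ^ (q - 1) = 1 + q * m ∧ fermatQuotient q t = m := by
  have h1 : 1 ≡ t ^ (q - 1) [MOD q] := by
    have := Nat.ModEq.pow_totient ht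
    rw [Nat.totient_prime hq] at this
    exact this.symm
  have h2 : t ≠ 0 := by
    rintro rfl
    exact hq.one_lt.ne' (by simpa using ht)
  have h3 : 1 ≤ t ^ (q - 1) := Nat.one_le_pow _ _ (Nat.pos_of_ne_zero h2)
  obtain ⟨m, hm⟩ := (Nat.modEq_iff_dvd' h3).1 h1
  refine ⟨m, by omega, ?_⟩
  rw [fermatQuotient, hm, Nat.mul_div_cancel_left _ hq.pos]

lemma one_add_mul_modEq_sq_iff {q : ℕ} (hq : 0 < q) (m n : ℕ) :
    1 + q * m ≡ 1 + q * n [MOD q ^ 2] ↔ (m : ZMod q) = n := by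
  rw [ZMod.natCast_eq_natCast_iff]
  constructor
  · intro h
    have h' := Nat.ModEq.add_left_cancel' 1 h
    rw [sq] at h'
    exact Nat.ModEq.mul_left_cancel' hq.ne' h'
  · intro h
    rw [sq]
    exact (h.mul_left' q).add_left 1

lemma fermatQuotient_eq_iff {q s t : ℕ} (hq : q.Prime) (hs : s.Coprime q) (ht : t.Coprime q) :
    fermatQuotient q s = fermatQuotient q t ↔ s ^ (q - 1) ≡ t ^ (q - 1) [MOD q ^ 2] := by
  obtain ⟨m, hm, hm'⟩ := exists_pow_eq_one_add_mul_fermatQuotient hq hs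
  obtain ⟨n, hn, hn'⟩ := exists_pow_eq_one_add_mul_fermatQuotient hq ht
  rw [hm, hn, hm', hn', one_add_mul_modEq_sq_iff hq.pos]

lemma fermatQuotient_congr {q s t : ℕ} (hq : q.Prime) (hs : s.Coprime q) (ht : t.Coprime q)
    (h : s ≡ t [MOD q ^ 2]) : fermatQuotient q s = fermatQuotient q t :=
  (fermatQuotient_eq_iff hq hs ht).2 (h.pow _)

lemma fermatQuotient_one {q : ℕ} : fermatQuotient q 1 = 0 := by
  simp [fermatQuotient]

lemma fermatQuotient_mul {q s t : ℕ} (hq : q.Prime) (hs : s.Coprime q) (ht : t.Coprime q) :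
    fermatQuotient q (s * t) = fermatQuotient q s + fermatQuotient q t := by
  obtain ⟨m, hm, hm'⟩ := exists_pow_eq_one_add_mul_fermatQuotient hq hs
  obtain ⟨n, hn, hn'⟩ := exists_pow_eq_one_add_mul_fermatQuotient hq ht
  obtain ⟨k, hk, hk'⟩ :=
    exists_pow_eq_one_add_mul_fermatQuotient hq (Nat.Coprime.mul_left hs ht)
  have h : k = m + n + q * m * n := by
    rw [mul_pow, hm, hn] at hk
    apply Nat.eq_of_mul_eq_mul_left hq.pos
    nlinarith
  rw [hm', hn', hk', h]
  simp

lemma modEq_sq_of_fermatQuotient_eq {q s t : ℕ} (hq : q.Prime) (hs : s.Coprime q)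
    (ht : t.Coprime q) (hst : s ≡ t [MOD q])
    (h : fermatQuotient q s = fermatQuotient q t) : s ≡ t [MOD q ^ 2] := by
  rw [fermatQuotient_eq_iff hq hs ht] at h
  have h1 : s ^ q ≡ t ^ q [MOD q ^ 2] := by
    have h2 : ((q : ℕ) : ℤ) ∣ (t : ℤ) - s := (Nat.modEq_iff_dvd).1 hst
    have h3 := dvd_sub_pow_of_dvd_sub h2 1
    rw [pow_one] at h3
    exact (Nat.modEq_iff_dvd).2 (by exact_mod_cast h3)
  have hq1 : q = (q - 1) + 1 := (Nat.succ_pred_prime hq).symm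
  have h4 : s ^ (q - 1) * s ≡ s ^ (q - 1) * t [MOD q ^ 2] := by
    calc s ^ (q - 1) * s = s ^ q := by rw [← pow_succ, ← hq1]
      _ ≡ t ^ q [MOD q ^ 2] := h1
      _ = t ^ (q - 1) * t := by rw [← pow_succ, ← hq1]
      _ ≡ s ^ (q - 1) * t [MOD q ^ 2] := h.symm.mul_right t
  exact Nat.ModEq.cancel_left_of_coprime
    (Nat.Coprime.pow_left 2 (Nat.Coprime.pow_right _ hs.symm)) h4

/-- For `t` prime to `pq`, the Euler quotient is `p` times the residue of a fixed multiple of the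
Fermat quotient of `t`. -/
lemma eulerQuotient_eq {p q t : ℕ} [Fact q.Prime] (hp : p.Prime) (hne : p ≠ q)
    (hdvd : p ∣ q - 1) (ht : t.Coprime (p * q)) :
    eulerQuotient p q t =
      p * (((p : ZMod q) - 1) / (p : ZMod q) ^ 2 * fermatQuotient q t).val := by
  have hq : q.Prime := Fact.out
  have htp : t.Coprime p := Nat.Coprime.coprime_mul_right_right ht
  have htq : t.Coprime q := Nat.Coprime.coprime_mul_left_right ht
  have hcop : Nat.Coprime p q := (Nat.coprime_primes hp hq).2 hne
  obtain ⟨m, hm, hm'⟩ := exists_pow_eq_one_add_mul_fermatQuotient hq htq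
  have hp2 : p ^ 2 ∣ t ^ ((p - 1) * (q - 1)) - 1 := by
    obtain ⟨k, hk⟩ := hdvd
    have h1 : t ^ Nat.totient (p ^ 2) ≡ 1 [MOD p ^ 2] :=
      Nat.ModEq.pow_totient (Nat.Coprime.pow_right 2 htp)
    rw [Nat.totient_prime_pow hp two_pos] at h1
    have h2 := h1.pow k
    rw [one_pow, ← pow_mul] at h2
    have h3 : p ^ (2 - 1) * (p - 1) * k = (p - 1) * (q - 1) := by rw [hk]; ring
    rw [h3] at h2
    exact (Nat.modEq_iff_dvd' (Nat.one_le_pow _ _ (Nat.pos_of_ne_zero (by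
      rintro rfl
      exact hp.one_lt.ne' (by simpa using htp))))).1 h2.symm
  have hq1 : q ∣ t ^ ((p - 1) * (q - 1)) - 1 := by
    rw [mul_comm, pow_mul, hm]
    have : 1 ≡ (1 + q * m) ^ (p - 1) [MOD q] := by
      have : 1 + q * m ≡ 1 [MOD q] := by simp [Nat.ModEq]
      simpa using (this.pow (p - 1)).symm
    exact (Nat.modEq_iff_dvd' (Nat.one_le_pow _ _ (by omega))).1 this
  obtain ⟨M, hM⟩ := Nat.Coprime.mul_dvd_of_dvd_of_dvd (hcop.pow_left 2) hp2 hq1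
  have hE : eulerQuotient p q t = p * (M % q) := by
    rw [eulerQuotient, if_pos ht, hM, show p ^ 2 * q * M = p * q * (p * M) by ring,
      Nat.mul_div_cancel_left _ (Nat.mul_pos hp.pos hq.pos), Nat.mul_mod_mul_left]
  have hkey : (p : ZMod q) ^ 2 * M = ((p : ZMod q) - 1) * m := by
    have h1 : (1 + q * m) ^ (p - 1) = 1 + q * (p ^ 2 * M) := by
      rw [← hm, ← pow_mul, mul_comm (q - 1)]
      have : 1 ≤ t ^ ((p - 1) * (q - 1)) := Nat.one_le_pow _ _ (Nat.pos_of_ne_zero (by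
        rintro rfl
        exact hp.one_lt.ne' (by simpa using htp)))
      rw [show q * (p ^ 2 * M) = p ^ 2 * q * M by ring, ← hM]
      omega
    have h2 : 1 + q * ((p - 1) * m) ≡ (1 + q * m) ^ (p - 1) [MOD q ^ 2] := by
      generalize p - 1 = n
      induction n with
      | zero => simp [Nat.ModEq]
      | succ n ih =>
        rw [pow_succ]
        refine Nat.ModEq.trans ?_ (ih.mul_right _)
        have : (1 + q * (n * m)) * (1 + q * m) = 1 + q * ((n + 1) * m) + q ^ 2 * (n * m * m) := by
          ring
        rw [this]
        exact (Nat.add_mul_mod_self_left _ _ _).symm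
    rw [h1, one_add_mul_modEq_sq_iff hq.pos] at h2
    push_cast [Nat.cast_sub hp.one_lt.le] at h2
    exact h2.symm
  have hp0 : (p : ZMod q) ≠ 0 := by
    rw [Ne, ZMod.natCast_eq_zero_iff, Nat.prime_dvd_prime_iff_eq hq hp]
    exact fun h => hne h.symm
  have hM' : ((p : ZMod q) - 1) / (p : ZMod q) ^ 2 * m = M := by
    field_simp
    linear_combination -hkey
  rw [hE, hm', hM', ZMod.val_natCast]

/-- The indicator function of the residues modulo `q` that exceed `q / 2`. -/
def upperHalf (K : Type*) [Field K] (q : ℕ) (x : ZMod q) : K :=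
  if 2 * x.val < q then 0 else 1

lemma upperHalf_sq {K : Type*} [Field K] {q : ℕ} (x : ZMod q) :
    upperHalf K q x ^ 2 = upperHalf K q x := by
  rw [upperHalf]
  split_ifs <;> simp

lemma upperHalf_add_upperHalf_add_one {K : Type*} [Field K] [CharP K 2] {q : ℕ} [NeZero q]
    (hq : 1 < q) (hodd : Odd q) (x : ZMod q) :
    upperHalf K q x + upperHalf K q (x + 1) =
      (if x = ((q / 2 : ℕ) : ZMod q) then 1 else 0) + (if x = -1 then 1 else 0) := by
  obtain ⟨n, hn, rfl⟩ : ∃ n < q, (n : ZMod q) = x :=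
    ⟨x.val, ZMod.val_lt x, ZMod.natCast_zmod_val x⟩
  obtain ⟨k, hk⟩ := hodd
  have h1 : (n : ZMod q) = ((q / 2 : ℕ) : ZMod q) ↔ n = k := by
    rw [ZMod.natCast_eq_natCast_iff, Nat.ModEq, Nat.mod_eq_of_lt hn, Nat.mod_eq_of_lt (by omega)]
    omega
  have h2 : (n : ZMod q) = -1 ↔ n = 2 * k := by
    rw [eq_neg_iff_add_eq_zero, ← Nat.cast_one, ← Nat.cast_add, ZMod.natCast_eq_zero_iff]
    constructor
    · intro h
      have := Nat.le_of_dvd (by omega) h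
      omega
    · intro h
      exact ⟨1, by omega⟩
  have h3 : ((n : ZMod q) + 1).val = if n = 2 * k then 0 else n + 1 := by
    rw [← Nat.cast_one, ← Nat.cast_add, ZMod.val_natCast]
    split_ifs with h
    · rw [h, ← hk, Nat.mod_self]
    · exact Nat.mod_eq_of_lt (by omega)
  have h4 : (1 : K) + 1 = 0 := CharTwo.add_self_eq_zero 1
  simp only [upperHalf, h1, h2, h3, ZMod.val_natCast, Nat.mod_eq_of_lt hn]
  split_ifs <;> first | omega | simp [h4]

lemma sum_upperHalf {K : Type*} [Field K] {q : ℕ} [NeZero q] (hodd : Odd q) :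
    ∑ x : ZMod q, upperHalf K q x = ((q / 2 : ℕ) : K) := by
  obtain ⟨k, hk⟩ := hodd
  have h1 : ∑ x : ZMod q, upperHalf K q x =
      ∑ n ∈ Finset.range q, if 2 * n < q then (0 : K) else 1 := by
    refine Finset.sum_bij (fun x _ => x.val) (fun x _ => Finset.mem_range.2 x.val_lt)
      (fun x _ y _ h => ZMod.val_injective q h)
      (fun n hn => ⟨n, Finset.mem_univ _, ZMod.val_cast_of_lt (Finset.mem_range.1 hn)⟩)
      (fun x _ => rfl)
  have h2 : (Finset.range q).filter (fun n => ¬ 2 * n < q) = Finset.Ico (k + 1) q := by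
    ext n
    simp only [Finset.mem_filter, Finset.mem_range, Finset.mem_Ico]
    omega
  rw [h1, Finset.sum_ite, Finset.sum_const_zero, zero_add, h2, Finset.sum_const, Nat.card_Ico,
    nsmul_one]
  congr 1
  omega

lemma sum_units_eq_sum_ite {R M : Type*} [Monoid R] [Fintype R] [Fintype Rˣ]
    [DecidablePred (IsUnit : R → Prop)] [AddCommMonoid M] (f : R → M) :
    ∑ u : Rˣ, f u = ∑ x : R, if IsUnit x then f x else 0 := by
  rw [← Finset.sum_filter]
  refine Finset.sum_bij (fun u _ => (u : R)) (fun u _ => by simp)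
    (fun u _ v _ h => Units.ext h) (fun x hx => ?_) (fun _ _ => rfl)
  obtain ⟨u, hu⟩ := (Finset.mem_filter.1 hx).2
  exact ⟨u, Finset.mem_univ _, hu⟩

lemma isNilpotent_natCast_zmod_sq (q : ℕ) : IsNilpotent ((q : ℕ) : ZMod (q ^ 2)) :=
  ⟨2, by rw [← Nat.cast_pow, ZMod.natCast_self]⟩

lemma isUnit_zmod_sq_iff {q : ℕ} (hq : q.Prime) {x : ZMod (q ^ 2)} :
    IsUnit x ↔ x.val.Coprime q := by
  have := NeZero.mk hq.ne_zero
  conv_lhs => rw [← ZMod.natCast_zmod_val x]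
  rw [ZMod.isUnit_iff_coprime, Nat.coprime_pow_right_iff two_pos]

lemma natCast_val_natCast_zmod_sq (q n : ℕ) :
    ((n : ZMod (q ^ 2)).val : ZMod q) = n := by
  rw [ZMod.val_natCast, ZMod.natCast_eq_natCast_iff]
  exact Nat.mod_mod_of_dvd n (dvd_pow_self q two_ne_zero)

lemma sum_units_addChar_eq_zero {K : Type*} [Field K] {q : ℕ} [NeZero q]
    {ψ : AddChar (ZMod (q ^ 2)) K} (hψ : ψ (q : ZMod (q ^ 2)) ≠ 1) :
    ∑ u : (ZMod (q ^ 2))ˣ, ψ u = 0 := by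
  classical
  rw [sum_units_eq_sum_ite (fun x => ψ x)]
  set U := ∑ x : ZMod (q ^ 2), if IsUnit x then ψ x else 0 with hU
  have h : U = U * ψ (q : ZMod (q ^ 2)) := by
    conv_lhs => rw [hU, ← Equiv.sum_comp (Equiv.addRight (q : ZMod (q ^ 2)))]
    rw [hU, Finset.sum_mul]
    refine Finset.sum_congr rfl fun x _ => ?_
    have hn := isNilpotent_natCast_zmod_sq q
    have : IsUnit (x + (q : ZMod (q ^ 2))) ↔ IsUnit x :=
      ⟨fun h => by simpa using hn.neg.isUnit_add_left_of_commute h (Commute.all _ _),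
        fun h => hn.isUnit_add_left_of_commute h (Commute.all _ _)⟩
    simp only [Equiv.coe_addRight, this, AddChar.map_add_eq_mul]
    split_ifs <;> simp
  have h' : U * (ψ (q : ZMod (q ^ 2)) - 1) = 0 := by linear_combination -h
  exact (mul_eq_zero.1 h').resolve_right (sub_ne_zero.2 hψ)

/-- The twisted sum over the units `u` of `ZMod (q ^ 2)` for which `L u + c` is in the upper
half. -/
noncomputable def halfSum {K : Type*} [Field K] {q : ℕ} [NeZero q]
    (L : (ZMod (q ^ 2))ˣ → ZMod q) (ψ : AddChar (ZMod (q ^ 2)) K) (c : ZMod q) : K :=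
  ∑ u : (ZMod (q ^ 2))ˣ, upperHalf K q (L u + c) * ψ u

/-- The sum of an additive character over a fibre of `L`. -/
noncomputable def fibreSum {K : Type*} [Field K] {q : ℕ} [NeZero q]
    (L : (ZMod (q ^ 2))ˣ → ZMod q) (ψ : AddChar (ZMod (q ^ 2)) K) (l : ZMod q) : K :=
  ∑ u : (ZMod (q ^ 2))ˣ, if L u = l then ψ u else 0

lemma halfSum_sq {K : Type*} [Field K] [CharP K 2] {q : ℕ} [NeZero q]
    {L : (ZMod (q ^ 2))ˣ → ZMod q} (hL : ∀ u v, L (u * v) = L u + L v)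
    (ψ : AddChar (ZMod (q ^ 2)) K) {w : (ZMod (q ^ 2))ˣ} (hw : (w : ZMod (q ^ 2)) = 2)
    (c : ZMod q) : halfSum L ψ c ^ 2 = halfSum L ψ (c - L w) := by
  rw [halfSum, CharTwo.sum_sq, halfSum]
  conv_rhs => rw [← Equiv.sum_comp (Equiv.mulLeft w)]
  refine Finset.sum_congr rfl fun u _ => ?_
  rw [mul_pow, upperHalf_sq, Equiv.coe_mulLeft, Units.val_mul, hw, hL, two_mul,
    AddChar.map_add_eq_mul, ← sq]
  congr 2
  ring

lemma halfSum_eq_zero_of_halfSum_eq_zero {K : Type*} [Field K] [CharP K 2] {q : ℕ}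
    [Fact q.Prime] {L : (ZMod (q ^ 2))ˣ → ZMod q} (hL : ∀ u v, L (u * v) = L u + L v)
    {ψ : AddChar (ZMod (q ^ 2)) K} {w : (ZMod (q ^ 2))ˣ} (hw : (w : ZMod (q ^ 2)) = 2)
    (hLw : L w ≠ 0) {c : ZMod q} (h : halfSum L ψ c = 0) (c' : ZMod q) :
    halfSum L ψ c' = 0 := by
  have h1 : ∀ n : ℕ, halfSum L ψ (c - n * L w) = 0 := by
    intro n
    induction n with
    | zero => simpa using h
    | succ n ih =>
      rw [show c - ((n + 1 : ℕ) : ZMod q) * L w = c - n * L w - L w by push_cast; ring,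
        ← halfSum_sq hL ψ hw, ih]
      simp
  have h2 := h1 ((c - c') / L w).val
  rw [ZMod.natCast_zmod_val, div_mul_cancel₀ _ hLw] at h2
  simpa using h2

lemma fibreSum_eq_zero {K : Type*} [Field K] [CharP K 2] {q : ℕ}
    [Fact q.Prime] (hodd : Odd q) {L : (ZMod (q ^ 2))ˣ → ZMod q}
    {ψ : AddChar (ZMod (q ^ 2)) K} (hψ : ψ (q : ZMod (q ^ 2)) ≠ 1)
    (h : ∀ c, halfSum L ψ c = 0) (l : ZMod q) : fibreSum L ψ l = 0 := by
  have hq : 1 < q := (Fact.out : q.Prime).one_lt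
  have h1 : ∀ c, fibreSum L ψ (((q / 2 : ℕ) : ZMod q) - c) = fibreSum L ψ (-1 - c) := by
    intro c
    rw [← CharTwo.add_eq_zero]
    refine Eq.trans ?_ ((congrArg₂ (· + ·) (h c) (h (c + 1))).trans (add_zero 0))
    simp only [halfSum, fibreSum]
    rw [← Finset.sum_add_distrib, ← Finset.sum_add_distrib]
    refine Finset.sum_congr rfl fun u _ => ?_
    rw [← add_mul, ← add_assoc, upperHalf_add_upperHalf_add_one hq hodd]
    simp only [eq_sub_iff_add_eq, add_mul, ite_mul, one_mul, zero_mul]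
  have hhalf : ((q / 2 : ℕ) : ZMod q) + 1 + (((q / 2 : ℕ) : ZMod q) + 1) = 1 := by
    obtain ⟨k, hk⟩ := hodd
    have h2 : q / 2 = k := by omega
    have h3 : ((2 * k + 1 : ℕ) : ZMod q) = 0 := by rw [← hk, ZMod.natCast_self]
    rw [h2]
    push_cast at h3
    linear_combination h3
  have h2 : ∀ l, fibreSum L ψ (l + (((q / 2 : ℕ) : ZMod q) + 1)) = fibreSum L ψ l := by
    intro l
    have := h1 (-1 - l)
    rwa [show ((q / 2 : ℕ) : ZMod q) - (-1 - l) = l + (((q / 2 : ℕ) : ZMod q) + 1) by ring,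
      show -1 - (-1 - l) = l by ring] at this
  have h3 : ∀ l, fibreSum L ψ (l + 1) = fibreSum L ψ l := by
    intro l
    rw [← hhalf, ← add_assoc, h2, h2]
  have h4 : ∀ n : ℕ, fibreSum L ψ n = fibreSum L ψ 0 := by
    intro n
    induction n with
    | zero => simp
    | succ n ih => rw [Nat.cast_succ, h3, ih]
  have h5 : ∀ l, fibreSum L ψ l = fibreSum L ψ 0 := by
    intro l
    rw [← ZMod.natCast_zmod_val l, h4]
  have h6 : ∑ l, fibreSum L ψ l = 0 := by
    simp only [fibreSum]
    rw [Finset.sum_comm]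
    simpa using sum_units_addChar_eq_zero hψ
  rw [h5]
  simp only [h5, Finset.sum_const, Finset.card_univ, ZMod.card, nsmul_eq_mul] at h6
  refine (mul_eq_zero.1 h6).resolve_left ?_
  rw [CharP.cast_eq_zero_iff K 2]
  obtain ⟨k, hk⟩ := hodd
  omega

lemma exists_fibreSum_ne_zero {K : Type*} [Field K] {q : ℕ} [Fact q.Prime] (hqK : (q : K) ≠ 0)
    {L : (ZMod (q ^ 2))ˣ → ZMod q} (hL : ∀ u v, L (u * v) = L u + L v)
    (hinj : ∀ u v : (ZMod (q ^ 2))ˣ, ((u : ZMod (q ^ 2)).val : ZMod q) = (v : ZMod (q ^ 2)).val →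
      L u = L v → u = v)
    {ψ : AddChar (ZMod (q ^ 2)) K} (hψ : ψ.IsPrimitive) : ∃ l, fibreSum L ψ l ≠ 0 := by
  classical
  by_contra! h
  have hq : q.Prime := Fact.out
  have hL1 : L 1 = 0 := by simpa using hL 1 1
  let E : ZMod (q ^ 2) → K := fun c => ∑ u : (ZMod (q ^ 2))ˣ, if L u = 0 then ψ (c * u) else 0
  have hE : ∀ v : (ZMod (q ^ 2))ˣ, E v = 0 := by
    intro v
    rw [← h (L v), fibreSum, ← Equiv.sum_comp (Equiv.mulLeft v)]
    simp [E, hL]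
  have hF : ∀ x : ZMod (q ^ 2), ∑ c, ψ (-(c * x)) * E c =
      ∑ u : (ZMod (q ^ 2))ˣ, if L u = 0 ∧ (u : ZMod (q ^ 2)) = x then (q : K) ^ 2 else 0 := by
    intro x
    simp only [E, Finset.mul_sum]
    rw [Finset.sum_comm]
    refine Finset.sum_congr rfl fun u _ => ?_
    by_cases hu : L u = 0
    · have h1 := AddChar.sum_mulShift ((u : ZMod (q ^ 2)) - x) hψ
      simp only [hu, if_true, true_and, ← AddChar.map_add_eq_mul]
      simp only [sub_eq_zero, ZMod.card] at h1
      rw [show ((q : K) ^ 2) = ((q ^ 2 : ℕ) : K) by push_cast; rfl, ← Nat.cast_zero, ← Nat.cast_ite]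
      convert h1 using 3 with c
      · ring
    · simp [hu]
  have hu : IsUnit (1 + (q : ZMod (q ^ 2))) := (isNilpotent_natCast_zmod_sq q).isUnit_one_add
  obtain ⟨w, hw⟩ := hu
  have hcongr : ∑ c, ψ (-(c * 1)) * E c = ∑ c, ψ (-(c * w)) * E c := by
    refine Finset.sum_congr rfl fun c _ => ?_
    by_cases hc : IsUnit c
    · obtain ⟨v, rfl⟩ := hc
      rw [hE v, mul_zero, mul_zero]
    · have : c * q = 0 := by
        rw [isUnit_zmod_sq_iff hq, Nat.coprime_comm, hq.coprime_iff_not_dvd, not_not] at hc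
        obtain ⟨k, hk⟩ := hc
        rw [← ZMod.natCast_zmod_val c, hk, ← Nat.cast_mul, ZMod.natCast_eq_zero_iff]
        exact ⟨k, by ring⟩
      rw [hw, mul_add, this, add_zero]
  rw [hF, hF] at hcongr
  have hw1 : w ≠ 1 := by
    rintro rfl
    rw [Units.val_one, left_eq_add, ZMod.natCast_eq_zero_iff] at hw
    have := Nat.le_of_dvd hq.pos hw
    nlinarith [hq.one_lt]
  have hLw : L w ≠ 0 := by
    intro h0
    refine hw1 (hinj _ _ ?_ (h0.trans hL1.symm))
    have h1 := natCast_val_natCast_zmod_sq q (1 + q)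
    have h2 := natCast_val_natCast_zmod_sq q 1
    push_cast at h1 h2
    rw [hw, Units.val_one, h1, h2, ZMod.natCast_self, add_zero]
  rw [Finset.sum_eq_single 1 (by rintro u - hu1; simp [hu1]) (by simp),
    Finset.sum_eq_zero] at hcongr
  · simp [hL1, hqK] at hcongr
  · rintro u -
    rw [if_neg]
    rintro ⟨h0, h1⟩
    rw [Units.ext h1] at h0
    exact hLw h0

lemma halfSum_ne_zero_of_isPrimitive {K : Type*} [Field K] [CharP K 2] {q : ℕ}
    [Fact q.Prime] (hodd : Odd q) {L : (ZMod (q ^ 2))ˣ → ZMod q}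
    (hL : ∀ u v, L (u * v) = L u + L v)
    (hinj : ∀ u v : (ZMod (q ^ 2))ˣ, ((u : ZMod (q ^ 2)).val : ZMod q) = (v : ZMod (q ^ 2)).val →
      L u = L v → u = v)
    {w : (ZMod (q ^ 2))ˣ} (hw : (w : ZMod (q ^ 2)) = 2) (hLw : L w ≠ 0)
    {ψ : AddChar (ZMod (q ^ 2)) K} (hψ : ψ.IsPrimitive) (hψq : ψ (q : ZMod (q ^ 2)) ≠ 1)
    (c : ZMod q) : halfSum L ψ c ≠ 0 := by
  intro h
  have hqK : (q : K) ≠ 0 := by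
    rw [Ne, CharP.cast_eq_zero_iff K 2]
    exact hodd.not_two_dvd_nat
  obtain ⟨l, hl⟩ := exists_fibreSum_ne_zero hqK hL hinj hψ
  exact hl (fibreSum_eq_zero hodd hψq (halfSum_eq_zero_of_halfSum_eq_zero hL hw hLw h) l)

lemma halfSum_zmodChar_of_pow_eq_one {K : Type*} [Field K] [CharP K 2] {q : ℕ} [Fact q.Prime]
    [DecidableEq K] (hodd : Odd q) {L : (ZMod (q ^ 2))ˣ → ZMod q}
    (hinj : ∀ u v : (ZMod (q ^ 2))ˣ, ((u : ZMod (q ^ 2)).val : ZMod q) = (v : ZMod (q ^ 2)).val →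
      L u = L v → u = v)
    {y : K} (hy : y ^ q ^ 2 = 1) (hyq : y ^ q = 1) (c : ZMod q) :
    halfSum L (AddChar.zmodChar (q ^ 2) hy) c = if y = 1 then 0 else ((q / 2 : ℕ) : K) := by
  have hq : q.Prime := Fact.out
  let red : (ZMod (q ^ 2))ˣ →* (ZMod q)ˣ := ZMod.unitsMap (dvd_pow_self q two_ne_zero)
  have hred : ∀ u, ((red u : (ZMod q)ˣ) : ZMod q) = ((u : ZMod (q ^ 2)).val : ZMod q) := by
    intro u
    simp [red, ZMod.unitsMap_val]
  have hbij : Function.Bijective fun u => (red u, L u) := by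
    rw [Fintype.bijective_iff_injective_and_card]
    refine ⟨fun u v h => hinj u v ?_ (congrArg Prod.snd h), ?_⟩
    · rw [← hred, ← hred, show red u = red v from congrArg Prod.fst h]
    · rw [Fintype.card_prod, ZMod.card_units_eq_totient, ZMod.card_units_eq_totient, ZMod.card,
        Nat.totient_prime_pow hq two_pos, Nat.totient_prime hq, mul_comm]
      simp
  have hsum : halfSum L (AddChar.zmodChar (q ^ 2) hy) c =
      (∑ r : (ZMod q)ˣ, AddChar.zmodChar q hyq r) * ∑ l, upperHalf K q (l + c) := by
    rw [Finset.sum_mul_sum, ← Fintype.sum_prod_type',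
      ← (Equiv.ofBijective _ hbij).sum_comp, halfSum]
    refine Finset.sum_congr rfl fun u _ => ?_
    rw [Equiv.ofBijective_apply, hred, AddChar.zmodChar_apply', AddChar.zmodChar_apply, mul_comm]
  have hhalf : ∑ l, upperHalf K q (l + c) = ((q / 2 : ℕ) : K) := by
    rw [← sum_upperHalf hodd]
    exact Equiv.sum_comp (Equiv.addRight c) (upperHalf K q)
  have hunits : ∑ r : (ZMod q)ˣ, AddChar.zmodChar q hyq r = if y = 1 then 0 else 1 := by
    have h1 : ∑ x : ZMod q, AddChar.zmodChar q hyq x =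
        1 + ∑ r : (ZMod q)ˣ, AddChar.zmodChar q hyq r := by
      rw [sum_units_eq_sum_ite (fun x => AddChar.zmodChar q hyq x),
        ← Finset.add_sum_erase _ _ (Finset.mem_univ (0 : ZMod q)), AddChar.map_zero_eq_one,
        ← Finset.add_sum_erase _ _ (Finset.mem_univ (0 : ZMod q)), if_neg not_isUnit_zero, zero_add]
      congr 1
      refine Finset.sum_congr rfl fun x hx => ?_
      rw [if_pos (isUnit_iff_ne_zero.2 (Finset.ne_of_mem_erase hx))]
    have h2 : (1 : K) + 1 = 0 := CharTwo.add_self_eq_zero 1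
    have h3 : ∑ r : (ZMod q)ˣ, AddChar.zmodChar q hyq r =
        1 + ∑ x : ZMod q, AddChar.zmodChar q hyq x := by
      rw [h1, ← add_assoc, h2, zero_add]
    rw [h3]
    split_ifs with h
    · subst h
      simp only [AddChar.zmodChar_apply, one_pow, Finset.sum_const, Finset.card_univ, ZMod.card,
        nsmul_one]
      obtain ⟨k, rfl⟩ := hodd
      push_cast
      rw [CharTwo.two_eq_zero, zero_mul, zero_add, h2]
    · rw [AddChar.sum_eq_zero_of_ne_one, add_zero]
      intro h4
      apply h
      have h5 := AddChar.zmodChar_apply' hyq 1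
      rw [h4] at h5
      simpa using h5.symm
  rw [hsum, hhalf, hunits]
  split_ifs <;> simp

lemma halfSum_zmodChar_ne_zero_iff {K : Type*} [Field K] [CharP K 2] {q : ℕ}
    [Fact q.Prime] (hodd : Odd q) {L : (ZMod (q ^ 2))ˣ → ZMod q}
    (hL : ∀ u v, L (u * v) = L u + L v)
    (hinj : ∀ u v : (ZMod (q ^ 2))ˣ, ((u : ZMod (q ^ 2)).val : ZMod q) = (v : ZMod (q ^ 2)).val →
      L u = L v → u = v)
    {w : (ZMod (q ^ 2))ˣ} (hw : (w : ZMod (q ^ 2)) = 2) (hLw : L w ≠ 0)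
    {y : K} (hy : y ^ q ^ 2 = 1) (c : ZMod q) :
    halfSum L (AddChar.zmodChar (q ^ 2) hy) c ≠ 0 ↔ y ^ q ≠ 1 ∨ y ≠ 1 ∧ q % 4 = 3 := by
  classical
  by_cases hyq : y ^ q = 1
  · rw [halfSum_zmodChar_of_pow_eq_one hodd hinj hy hyq]
    have h : ((q / 2 : ℕ) : K) ≠ 0 ↔ q % 4 = 3 := by
      rw [Ne, CharP.cast_eq_zero_iff K 2]
      obtain ⟨k, rfl⟩ := hodd
      omega
    by_cases hy1 : y = 1 <;> simp [hy1, hyq, ← h]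
  · simp only [ne_eq, hyq, not_false_eq_true, true_or, iff_true]
    have hy' : IsPrimitiveRoot y (q ^ 2) := by
      rw [IsPrimitiveRoot.iff_orderOf]
      exact orderOf_eq_prime_pow (by simpa using hyq) hy
    refine halfSum_ne_zero_of_isPrimitive hodd hL hinj hw hLw
      (AddChar.zmodChar_primitive_of_primitive_root _ hy') ?_ c
    rwa [AddChar.zmodChar_apply']

lemma sum_range_mul_eq_sum_sum {M : Type*} [AddCommMonoid M] (f : ℕ → M) (n m : ℕ) :
    ∑ t ∈ Finset.range (n * m), f t =
      ∑ i ∈ Finset.range n, ∑ j ∈ Finset.range m, f (m * i + j) := by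
  induction n with
  | zero => simp
  | succ n ih => rw [Nat.succ_mul, Finset.sum_range_add, ih, Finset.sum_range_succ, mul_comm n m]

lemma sum_range_mul_ite_dvd {M : Type*} [AddCommMonoid M] (f : ℕ → M) {p : ℕ} (hp : 0 < p)
    (m : ℕ) :
    ∑ t ∈ Finset.range (p * m), (if p ∣ t then f t else 0) =
      ∑ j ∈ Finset.range m, f (p * j) := by
  rw [mul_comm, sum_range_mul_eq_sum_sum]
  refine Finset.sum_congr rfl fun i _ => ?_
  rw [Finset.sum_eq_single_of_mem 0 (Finset.mem_range.2 hp)]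
  · simp
  · intro j hj hj0
    rw [if_neg]
    rw [Nat.dvd_add_right (dvd_mul_right p i)]
    exact Nat.not_dvd_of_pos_of_lt (Nat.pos_of_ne_zero hj0) (Finset.mem_range.1 hj)

lemma sum_range_natCast_zmod {M : Type*} [AddCommMonoid M] {n : ℕ} [NeZero n] (f : ZMod n → M) :
    ∑ t ∈ Finset.range n, f t = ∑ x, f x := by
  refine Finset.sum_bij' (fun t _ => (t : ZMod n)) (fun x _ => x.val) ?_ ?_ ?_ ?_ ?_
  · simp
  · exact fun x _ => Finset.mem_range.2 x.val_lt
  · exact fun t ht => ZMod.val_cast_of_lt (Finset.mem_range.1 ht)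
  · exact fun x _ => ZMod.natCast_zmod_val x
  · exact fun _ _ => rfl

lemma sum_range_mul_natCast_zmod {K : Type*} [Ring K] {n : ℕ} [NeZero n] (p : ℕ)
    (f : ZMod n → K) : ∑ t ∈ Finset.range (p * n), f t = p * ∑ x, f x := by
  rw [sum_range_mul_eq_sum_sum]
  simp [sum_range_natCast_zmod f]

/-- The extension by zero of the indicator of `{u | L u is in the upper half}`. -/
noncomputable def unitUpperHalf (K : Type*) [Field K] {q : ℕ}
    (L : (ZMod (q ^ 2))ˣ → ZMod q) (x : ZMod (q ^ 2)) : K :=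
  open Classical in if h : IsUnit x then upperHalf K q (L h.unit) else 0

lemma sum_eq_zero_of_pow_sq_eq_one {K : Type*} [Field K] [CharP K 2] {p q : ℕ} [NeZero q]
    (hp : 0 < p) (hodd : Odd p) (hpu : IsUnit (p : ZMod (q ^ 2))) (f : ZMod (q ^ 2) → K)
    {x : K} (hx : x ^ q ^ 2 = 1) :
    ∑ t ∈ Finset.range (p * q ^ 2), (if p ∣ t then 0 else f t) * x ^ t = 0 := by
  have h1 : ∀ t : ℕ, f t * x ^ t = f t * AddChar.zmodChar (q ^ 2) hx t := by
    intro t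
    rw [AddChar.zmodChar_apply']
  have h2 : ∀ t : ℕ, (if p ∣ t then 0 else f t) * x ^ t =
      f t * x ^ t - if p ∣ t then f t * x ^ t else 0 := by
    intro t
    split_ifs <;> simp
  simp only [h2]
  rw [Finset.sum_sub_distrib, sum_range_mul_ite_dvd (fun t => f t * x ^ t) hp]
  simp only [h1]
  rw [sum_range_mul_natCast_zmod p (fun y => f y * AddChar.zmodChar (q ^ 2) hx y)]
  simp only [Nat.cast_mul]
  rw [sum_range_natCast_zmod
    (fun y => f ((p : ZMod (q ^ 2)) * y) * AddChar.zmodChar (q ^ 2) hx ((p : ZMod (q ^ 2)) * y))]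
  obtain ⟨w, hw⟩ := hpu
  have h3 := Equiv.sum_comp w.mulLeft (fun y => f y * AddChar.zmodChar (q ^ 2) hx y)
  simp only [Units.mulLeft_apply] at h3
  rw [← hw, h3]
  obtain ⟨k, rfl⟩ := hodd
  push_cast
  rw [CharTwo.two_eq_zero]
  ring

lemma sum_eq_halfSum_of_pow_sq_ne_one {K : Type*} [Field K] [CharP K 2] {p q : ℕ} [NeZero q]
    (hp : 0 < p) {L : (ZMod (q ^ 2))ˣ → ZMod q}
    (hL : ∀ u v, L (u * v) = L u + L v) {w : (ZMod (q ^ 2))ˣ} (hw : (w : ZMod (q ^ 2)) = p)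
    {x : K} (hx : x ^ (p * q ^ 2) = 1) (hx' : x ^ q ^ 2 ≠ 1) (hxp : (x ^ p) ^ q ^ 2 = 1) :
    ∑ t ∈ Finset.range (p * q ^ 2), (if p ∣ t then 0 else unitUpperHalf K L t) * x ^ t =
      halfSum L (AddChar.zmodChar (q ^ 2) hxp) (L w) := by
  classical
  have h2 : ∀ t : ℕ, (if p ∣ t then 0 else unitUpperHalf K L t) * x ^ t =
      unitUpperHalf K L t * x ^ t + if p ∣ t then unitUpperHalf K L t * x ^ t else 0 := by
    intro t
    split_ifs <;> simp [CharTwo.add_self_eq_zero]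
  simp only [h2]
  rw [Finset.sum_add_distrib,
    sum_range_mul_ite_dvd (fun t => unitUpperHalf K L t * x ^ t) hp, sum_range_mul_eq_sum_sum]
  have h3 : ∑ i ∈ Finset.range p, (x ^ q ^ 2) ^ i = 0 := by
    have := mul_geom_sum (x ^ q ^ 2) p
    rw [← pow_mul, mul_comm (q ^ 2) p, hx, sub_self] at this
    exact (mul_eq_zero.1 this).resolve_left (sub_ne_zero.2 hx')
  have h4 : ∑ i ∈ Finset.range p, ∑ j ∈ Finset.range (q ^ 2),
      unitUpperHalf K L ((q ^ 2 * i + j : ℕ) : ZMod (q ^ 2)) * x ^ (q ^ 2 * i + j) = 0 := by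
    have : ∀ i j : ℕ,
        unitUpperHalf K L ((q ^ 2 * i + j : ℕ) : ZMod (q ^ 2)) * x ^ (q ^ 2 * i + j) =
          (x ^ q ^ 2) ^ i * (unitUpperHalf K L j * x ^ j) := by
      intro i j
      rw [Nat.cast_add, Nat.cast_mul, ZMod.natCast_self, zero_mul, zero_add, pow_add, pow_mul]
      ring
    simp only [this]
    rw [← Finset.sum_mul_sum, h3, zero_mul]
  rw [h4, zero_add]
  simp only [Nat.cast_mul, pow_mul, ← AddChar.zmodChar_apply' hxp]
  rw [sum_range_natCast_zmod
    (fun y => unitUpperHalf K L ((p : ZMod (q ^ 2)) * y) * AddChar.zmodChar (q ^ 2) hxp y), ← hw, halfSum]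
  have h5 : ∀ y : ZMod (q ^ 2),
      unitUpperHalf K L ((w : ZMod (q ^ 2)) * y) * AddChar.zmodChar (q ^ 2) hxp y =
        if IsUnit y then unitUpperHalf K L ((w : ZMod (q ^ 2)) * y) * AddChar.zmodChar (q ^ 2) hxp y
        else 0 := by
    intro y
    split_ifs with h
    · rfl
    · rw [unitUpperHalf, dif_neg (by simpa using h), zero_mul]
  rw [Finset.sum_congr rfl fun y _ => h5 y,
    ← sum_units_eq_sum_ite
      (fun y => unitUpperHalf K L ((w : ZMod (q ^ 2)) * y) * AddChar.zmodChar (q ^ 2) hxp y)]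
  refine Finset.sum_congr rfl fun u _ => ?_
  rw [← Units.val_mul, unitUpperHalf, dif_pos (Units.isUnit _), IsUnit.unit_of_val_units, hL,
    add_comm]

/-- The map on units modulo `q ^ 2` given by a multiple `κ` of the Fermat quotient. -/
def scaledFermatQuotient {q : ℕ} (κ : ZMod q) (u : (ZMod (q ^ 2))ˣ) : ZMod q :=
  κ * fermatQuotient q (u : ZMod (q ^ 2)).val

lemma coprime_val_unit {q : ℕ} (hq : q.Prime) (u : (ZMod (q ^ 2))ˣ) :
    (u : ZMod (q ^ 2)).val.Coprime q :=
  (isUnit_zmod_sq_iff hq).1 u.isUnit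

lemma scaledFermatQuotient_of_eq_natCast {q : ℕ} (hq : q.Prime) (κ : ZMod q)
    {u : (ZMod (q ^ 2))ˣ} {t : ℕ} (ht : t.Coprime q) (h : (u : ZMod (q ^ 2)) = t) :
    scaledFermatQuotient κ u = κ * fermatQuotient q t := by
  rw [scaledFermatQuotient, fermatQuotient_congr hq (coprime_val_unit hq u) ht]
  rw [h, ZMod.val_natCast]
  exact Nat.mod_modEq _ _

lemma scaledFermatQuotient_mul {q : ℕ} (hq : q.Prime) (κ : ZMod q) (u v : (ZMod (q ^ 2))ˣ) :
    scaledFermatQuotient κ (u * v) = scaledFermatQuotient κ u + scaledFermatQuotient κ v := by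
  have := NeZero.mk hq.ne_zero
  have hu := coprime_val_unit hq u
  have hv := coprime_val_unit hq v
  rw [scaledFermatQuotient_of_eq_natCast hq κ (Nat.Coprime.mul_left hu hv) (by simp),
    fermatQuotient_mul hq hu hv, mul_add]
  rfl

lemma eq_of_scaledFermatQuotient_eq {q : ℕ} [Fact q.Prime] {κ : ZMod q} (hκ : κ ≠ 0)
    (u v : (ZMod (q ^ 2))ˣ) (h : ((u : ZMod (q ^ 2)).val : ZMod q) = (v : ZMod (q ^ 2)).val)
    (h' : scaledFermatQuotient κ u = scaledFermatQuotient κ v) : u = v := by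
  have hq : q.Prime := Fact.out
  have h1 := modEq_sq_of_fermatQuotient_eq hq (coprime_val_unit hq u) (coprime_val_unit hq v)
    ((ZMod.natCast_eq_natCast_iff _ _ _).1 h) (mul_left_cancel₀ hκ h')
  rw [← ZMod.natCast_eq_natCast_iff, ZMod.natCast_zmod_val, ZMod.natCast_zmod_val] at h1
  exact Units.ext h1

lemma algebraMap_binSeq {K : Type*} [Field K] [Algebra (ZMod 2) K] {p q : ℕ} [Fact q.Prime]
    (hp : p.Prime) (hne : p ≠ q) (hdvd : p ∣ q - 1) (t : ℕ) :
    algebraMap (ZMod 2) K (binSeq p q t) =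
      if p ∣ t then 0 else unitUpperHalf K
        (scaledFermatQuotient (((p : ZMod q) - 1) / (p : ZMod q) ^ 2)) t := by
  have hq : q.Prime := Fact.out
  have hpos : 0 < p * q := Nat.mul_pos hp.pos hq.pos
  by_cases ht : t.Coprime (p * q)
  · have htq : t.Coprime q := Nat.Coprime.coprime_mul_left_right ht
    have hpt : ¬ p ∣ t :=
      (hp.coprime_iff_not_dvd).1 (Nat.Coprime.coprime_mul_right_right ht).symm
    have hu : IsUnit (t : ZMod (q ^ 2)) := by
      rw [ZMod.isUnit_iff_coprime, Nat.coprime_pow_right_iff two_pos]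
      exact htq
    rw [if_neg hpt, unitUpperHalf, dif_pos hu,
      scaledFermatQuotient_of_eq_natCast hq _ htq (IsUnit.unit_spec hu), upperHalf, binSeq,
      eulerQuotient_eq hp hne hdvd ht, mul_left_comm 2 p]
    simp only [Nat.mul_lt_mul_left hp.pos]
    split_ifs <;> simp
  · have h0 : binSeq p q t = 0 := by
      rw [binSeq, eulerQuotient, if_neg ht, if_pos (by simpa using hpos)]
    rw [h0, map_zero]
    split_ifs with hpt
    · rfl
    · rw [unitUpperHalf, dif_neg]
      rw [ZMod.isUnit_iff_coprime, Nat.coprime_pow_right_iff two_pos]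
      exact fun htq => ht (Nat.Coprime.mul_right ((hp.coprime_iff_not_dvd).2 hpt).symm htq)

lemma sum_algebraMap_binSeq_ne_zero_iff {K : Type*} [Field K] [Algebra (ZMod 2) K] {p q : ℕ}
    (hp : p.Prime) (hq : q.Prime) (hpodd : Odd p) (hqodd : Odd q) (hne : p ≠ q)
    (hdvd : p ∣ q - 1) (h2 : ¬ (2 ^ (q - 1) ≡ 1 [MOD q ^ 2])) {x : K}
    (hx : x ^ (p * q ^ 2) = 1) :
    ∑ t ∈ Finset.range (p * q ^ 2), algebraMap (ZMod 2) K (binSeq p q t) * x ^ t ≠ 0 ↔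
      x ^ q ^ 2 ≠ 1 ∧ (x ^ (p * q) ≠ 1 ∨ x ^ p ≠ 1 ∧ q % 4 = 3) := by
  have := Fact.mk hq
  have : CharP K 2 := charP_of_injective_algebraMap (algebraMap (ZMod 2) K).injective 2
  have hpq : p.Coprime q := (Nat.coprime_primes hp hq).2 hne
  have hpu : IsUnit (p : ZMod (q ^ 2)) := by
    rw [ZMod.isUnit_iff_coprime, Nat.coprime_pow_right_iff two_pos]
    exact hpq
  simp only [algebraMap_binSeq hp hne hdvd]
  by_cases hx' : x ^ q ^ 2 = 1
  · rw [sum_eq_zero_of_pow_sq_eq_one hp.pos hpodd hpu _ hx']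
    simp [hx']
  · have hκ : ((p : ZMod q) - 1) / (p : ZMod q) ^ 2 ≠ 0 := by
      refine div_ne_zero ?_ (pow_ne_zero 2 ?_)
      · rw [← Nat.cast_one, ← Nat.cast_sub hp.one_lt.le, Ne, ZMod.natCast_eq_zero_iff]
        intro h
        have h3 := Nat.le_of_dvd (Nat.sub_pos_of_lt hp.one_lt) h
        have h4 := Nat.le_of_dvd (Nat.sub_pos_of_lt hq.one_lt) hdvd
        have := hp.one_lt
        omega
      · rw [Ne, ZMod.natCast_eq_zero_iff, Nat.prime_dvd_prime_iff_eq hq hp]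
        exact fun h => hne h.symm
    have h2q : Nat.Coprime 2 q := hqodd.coprime_two_left
    have h2u : IsUnit ((2 : ℕ) : ZMod (q ^ 2)) := by
      rw [ZMod.isUnit_iff_coprime, Nat.coprime_pow_right_iff two_pos]
      exact h2q
    obtain ⟨w, hw⟩ := h2u
    obtain ⟨v, hv⟩ := hpu
    have hxp : (x ^ p) ^ q ^ 2 = 1 := by rw [← pow_mul, hx]
    rw [sum_eq_halfSum_of_pow_sq_ne_one hp.pos (scaledFermatQuotient_mul hq _) hv hx hx' hxp,
      halfSum_zmodChar_ne_zero_iff hqodd (scaledFermatQuotient_mul hq _)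
        (eq_of_scaledFermatQuotient_eq hκ) (by simpa using hw), ← pow_mul]
    · simp [hx']
    · rw [scaledFermatQuotient_of_eq_natCast hq _ h2q hw]
      refine mul_ne_zero hκ fun h => h2 ?_
      rw [← fermatQuotient_one, fermatQuotient_eq_iff hq h2q (Nat.coprime_one_left q),
        one_pow] at h
      exact h

open Polynomial in
lemma card_nthRootsFinset_of_odd {K : Type*} [Field K] [IsAlgClosed K] [CharP K 2] {n : ℕ}
    (hn : Odd n) : (nthRootsFinset n (1 : K)).card = n := by
  have : NeZero (n : K) := ⟨by
    rw [Ne, CharP.cast_eq_zero_iff K 2]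
    exact hn.not_two_dvd_nat⟩
  obtain ⟨ζ, hζ⟩ := HasEnoughRootsOfUnity.exists_primitiveRoot K n
  exact hζ.card_nthRootsFinset

open Polynomial in
lemma card_nthRootsFinset_filter_ne_one {K : Type*} [Field K] [IsAlgClosed K] [CharP K 2]
    [DecidableEq K] {n a b : ℕ} (hn : Odd n) (ha : a ∣ n) (hb : b ∣ n) :
    ((nthRootsFinset n (1 : K)).filter fun x => x ^ a ≠ 1 ∧ x ^ b ≠ 1).card =
      n + a.gcd b - a - b := by
  have hao : Odd a := hn.of_dvd_nat ha
  have hbo : Odd b := hn.of_dvd_nat hb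
  have hgo : Odd (a.gcd b) := hao.of_dvd_nat (Nat.gcd_dvd_left a b)
  have hmem : ∀ {m : ℕ}, Odd m → ∀ x : K, x ∈ nthRootsFinset m (1 : K) ↔ x ^ m = 1 :=
    fun hm x => mem_nthRootsFinset hm.pos 1
  have h1 : (nthRootsFinset n (1 : K)).filter (fun x => x ^ a ≠ 1 ∧ x ^ b ≠ 1) =
      nthRootsFinset n (1 : K) \ (nthRootsFinset a (1 : K) ∪ nthRootsFinset b (1 : K)) := by
    ext x
    simp only [Finset.mem_filter, Finset.mem_sdiff, Finset.mem_union, hmem hn, hmem hao, hmem hbo,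
      not_or, ne_eq]
  have h2 : nthRootsFinset a (1 : K) ∪ nthRootsFinset b (1 : K) ⊆ nthRootsFinset n (1 : K) := by
    intro x
    simp only [Finset.mem_union, hmem hn, hmem hao, hmem hbo]
    rintro (h | h)
    · exact orderOf_dvd_iff_pow_eq_one.1 ((orderOf_dvd_of_pow_eq_one h).trans ha)
    · exact orderOf_dvd_iff_pow_eq_one.1 ((orderOf_dvd_of_pow_eq_one h).trans hb)
  have h3 : nthRootsFinset a (1 : K) ∩ nthRootsFinset b (1 : K) =
      nthRootsFinset (a.gcd b) (1 : K) := by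
    ext x
    simp only [Finset.mem_inter, hmem hao, hmem hbo, hmem hgo]
    exact ⟨fun h => pow_gcd_eq_one.2 h, fun h => pow_gcd_eq_one.1 h⟩
  have h4 := Finset.card_union_add_card_inter (nthRootsFinset a (1 : K)) (nthRootsFinset b (1 : K))
  rw [h3, card_nthRootsFinset_of_odd hao, card_nthRootsFinset_of_odd hbo,
    card_nthRootsFinset_of_odd hgo] at h4
  rw [h1, Finset.card_sdiff_of_subset h2, card_nthRootsFinset_of_odd hn]
  omega

open Polynomial in
lemma sub_natDegree_gcd_eq_card {F K : Type*} [Field F] [DecidableEq F] [Field K] [IsAlgClosed K]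
    [DecidableEq K] [Algebra F K] {n : ℕ} (hn : (n : F) ≠ 0) (A : F[X])
    (hcard : (nthRootsFinset n (1 : K)).card = n) :
    n - (EuclideanDomain.gcd (X ^ n - 1) A).natDegree =
      ((nthRootsFinset n (1 : K)).filter fun x => aeval x A ≠ 0).card := by
  have hn0 : 0 < n := Nat.pos_of_ne_zero (by rintro rfl; simp at hn)
  set g := EuclideanDomain.gcd (X ^ n - 1) A with hg
  have hsep : g.Separable :=
    (X_pow_sub_one_separable_iff.2 hn).of_dvd (EuclideanDomain.gcd_dvd_left _ _)
  have hdeg : g.natDegree = ((nthRootsFinset n (1 : K)).filter fun x => aeval x A = 0).card := by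
    rw [← card_rootSet_eq_natDegree (K := K) hsep (IsAlgClosed.splits _), ← Set.toFinset_card]
    congr 1
    ext x
    rw [Set.mem_toFinset, mem_rootSet, Finset.mem_filter, mem_nthRootsFinset hn0, aeval_def, hg,
      root_gcd_iff_root_left_right, aeval_def]
    simp only [eval₂_sub, eval₂_pow, eval₂_X, eval₂_one, sub_eq_zero]
    exact and_iff_right hsep.ne_zero
  have := Finset.card_filter_add_card_filter_not (s := nthRootsFinset n (1 : K))
    (fun x => aeval x A = 0)
  rw [hcard, ← hdeg] at this
  simp only [ne_eq]
  omega

open Polynomial in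
theorem stmt_18 (p q : ℕ) (hp : p.Prime) (hq : q.Prime) (hpodd : Odd p) (hqodd : Odd q)
    (hne : p ≠ q) (hdvd : p ∣ q - 1)
    (h2 : ¬ (2 ^ (q - 1) ≡ 1 [MOD q ^ 2])) :
    (q % 4 = 1 →
      p * q ^ 2 -
          (EuclideanDomain.gcd ((X : (ZMod 2)[X]) ^ (p * q ^ 2) - 1)
            (∑ t ∈ Finset.range (p * q ^ 2), C (binSeq p q t) * X ^ t)).natDegree =
        (p - 1) * (q ^ 2 - q)) ∧
    (q % 4 = 3 →
      p * q ^ 2 -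
          (EuclideanDomain.gcd ((X : (ZMod 2)[X]) ^ (p * q ^ 2) - 1)
            (∑ t ∈ Finset.range (p * q ^ 2), C (binSeq p q t) * X ^ t)).natDegree =
        (p - 1) * (q ^ 2 - 1)) := by
  classical
  let K := AlgebraicClosure (ZMod 2)
  have : CharP K 2 := charP_of_injective_algebraMap (algebraMap (ZMod 2) K).injective 2
  have hN : Odd (p * q ^ 2) := hpodd.mul hqodd.pow
  have hN0 : ((p * q ^ 2 : ℕ) : ZMod 2) ≠ 0 := by
    rw [Ne, CharP.cast_eq_zero_iff (ZMod 2) 2]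
    exact hN.not_two_dvd_nat
  have hpq : p.Coprime q := (Nat.coprime_primes hp hq).2 hne
  have hcard := sub_natDegree_gcd_eq_card (K := K) hN0
    (∑ t ∈ Finset.range (p * q ^ 2), C (binSeq p q t) * X ^ t) (card_nthRootsFinset_of_odd hN)
  have hfilter : ((nthRootsFinset (p * q ^ 2) (1 : K)).filter fun x =>
      aeval x (∑ t ∈ Finset.range (p * q ^ 2), C (binSeq p q t) * X ^ t) ≠ 0) =
      (nthRootsFinset (p * q ^ 2) (1 : K)).filter fun x =>
        x ^ q ^ 2 ≠ 1 ∧ (x ^ (p * q) ≠ 1 ∨ x ^ p ≠ 1 ∧ q % 4 = 3) := by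
    refine Finset.filter_congr fun x hx => ?_
    rw [mem_nthRootsFinset hN.pos] at hx
    rw [← sum_algebraMap_binSeq_ne_zero_iff hp hq hpodd hqodd hne hdvd h2 hx]
    simp
  rw [hcard, hfilter]
  obtain ⟨r, hr⟩ : ∃ r, p = r + 1 := ⟨p - 1, (Nat.succ_pred_prime hp).symm⟩
  have hmul : ∀ n, p * n = r * n + n := fun n => by rw [hr, Nat.succ_mul]
  have hr' : p - 1 = r := by omega
  have hqq : q ≤ q ^ 2 := Nat.le_self_pow two_ne_zero q
  constructor
  · intro h
    have h1 : q % 4 ≠ 3 := by omega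
    have hgcd : (q ^ 2).gcd (p * q) = q := by
      rw [sq, Nat.gcd_mul_right, hpq.symm, one_mul]
    simp only [h1, and_false, or_false]
    rw [card_nthRootsFinset_filter_ne_one hN (dvd_mul_left _ _) ⟨q, by ring⟩, hgcd]
    have := Nat.mul_le_mul_left r hqq
    rw [hr', Nat.mul_sub, hmul, hmul]
    omega
  · intro h
    have hgcd : (q ^ 2).gcd p = 1 := hpq.symm.pow_left 2
    have h1 : ∀ x : K, (x ^ (p * q) ≠ 1 ∨ x ^ p ≠ 1 ∧ q % 4 = 3) ↔ x ^ p ≠ 1 := by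
      intro x
      simp only [h, and_true, or_iff_right_iff_imp]
      exact fun h2 h3 => h2 (by rw [pow_mul, h3, one_pow])
    simp only [h1]
    rw [card_nthRootsFinset_filter_ne_one hN (dvd_mul_left _ _) (dvd_mul_right _ _), hgcd]
    have := Nat.mul_le_mul_left r (hq.pos.trans_le hqq)
    rw [hr', Nat.mul_sub, hmul]
    omega
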